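/- Let H be a Hopf π-coalgebra over a field k. (a) If H is cosemisimple, then the Hopf algebra H_1 is cosemisimple. (b) If H is finite dimensional, then H is cosemisimple if and only if H_1 is cosemisimple. -/

import Mathlib

open scoped TensorProduct

noncomputable section

/-- Transport of the algebra structure along an equality of group indices. -/
def gcast (k : Type*) [CommSemiring k] {π : Type*} (H : π → Type*)
    [∀ α, Ring (H α)] [∀ α, Algebra k (H α)] {a b : π} (h : a = b) :
    H a ≃ₐ[k] H b := by subst h; exact AlgEquiv.refl

/-- Transport of a module family along an equality of group indices. -/
def fcast (k : Type*) [CommSemiring k] {π : Type*} (M : π → Type*)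
    [∀ α, AddCommGroup (M α)] [∀ α, Module k (M α)] {a b : π} (h : a = b) :
    M a ≃ₗ[k] M b := by subst h; exact LinearEquiv.refl k (M a)

/-- A Hopf `π`-coalgebra (in the sense of Turaev/Virelizier) over a field `k`:
a family of `k`-algebras `H α` with comultiplication `Δ`, counit `ε` and antipode `S`. -/
class HopfGCoalgebra (k : Type*) [Field k] {π : Type*} [Group π]
    (H : π → Type*) [∀ α, Ring (H α)] [∀ α, Algebra k (H α)] where
  Δ : ∀ α β : π, H (α * β) →ₐ[k] H α ⊗[k] H β
  ε : H (1 : π) →ₐ[k] k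
  S : ∀ α : π, H α →ₗ[k] H α⁻¹
  coassoc : ∀ α β γ : π,
    (TensorProduct.assoc k (H α) (H β) (H γ)).toLinearMap ∘ₗ
        (TensorProduct.map (Δ α β).toLinearMap (LinearMap.id : H γ →ₗ[k] H γ)) ∘ₗ
        (Δ (α * β) γ).toLinearMap
      = (TensorProduct.map (LinearMap.id : H α →ₗ[k] H α) (Δ β γ).toLinearMap) ∘ₗ
        (Δ α (β * γ)).toLinearMap ∘ₗ (gcast k H (mul_assoc α β γ)).toLinearMap
  counit_right : ∀ α : π,
    (TensorProduct.rid k (H α)).toLinearMap ∘ₗ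
        (TensorProduct.map (LinearMap.id : H α →ₗ[k] H α) ε.toLinearMap) ∘ₗ
        (Δ α 1).toLinearMap ∘ₗ (gcast k H (mul_one α).symm).toLinearMap = LinearMap.id
  counit_left : ∀ α : π,
    (TensorProduct.lid k (H α)).toLinearMap ∘ₗ
        (TensorProduct.map ε.toLinearMap (LinearMap.id : H α →ₗ[k] H α)) ∘ₗ
        (Δ 1 α).toLinearMap ∘ₗ (gcast k H (one_mul α).symm).toLinearMap = LinearMap.id
  antipode_left : ∀ α : π,
    (LinearMap.mul' k (H α)) ∘ₗ
        (TensorProduct.map ((gcast k H (inv_inv α)).toLinearMap ∘ₗ S α⁻¹)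
          (LinearMap.id : H α →ₗ[k] H α)) ∘ₗ (Δ α⁻¹ α).toLinearMap
      = (Algebra.linearMap k (H α)) ∘ₗ ε.toLinearMap ∘ₗ
        (gcast k H (inv_mul_cancel α)).toLinearMap
  antipode_right : ∀ α : π,
    (LinearMap.mul' k (H α)) ∘ₗ
        (TensorProduct.map (LinearMap.id : H α →ₗ[k] H α)
          ((gcast k H (inv_inv α)).toLinearMap ∘ₗ S α⁻¹)) ∘ₗ (Δ α α⁻¹).toLinearMap
      = (Algebra.linearMap k (H α)) ∘ₗ ε.toLinearMap ∘ₗ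
        (gcast k H (mul_inv_cancel α)).toLinearMap

namespace HopfGCoalgebra

variable (k : Type*) [Field k] {π : Type*} [Group π] (H : π → Type*)
  [∀ α, Ring (H α)] [∀ α, Algebra k (H α)] [HopfGCoalgebra k H]

/-- A left `π`-integral for `H`. -/
def IsLeftIntegral (lam : ∀ α : π, H α →ₗ[k] k) : Prop :=
  ∀ (α β : π) (x : H (α * β)),
    (TensorProduct.rid k (H α))
        (TensorProduct.map (LinearMap.id : H α →ₗ[k] H α) (lam β) (Δ α β x))
      = lam (α * β) x • (1 : H α)

/-- A right `π`-integral for `H`. -/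
def IsRightIntegral (lam : ∀ α : π, H α →ₗ[k] k) : Prop :=
  ∀ (α β : π) (x : H (α * β)),
    (TensorProduct.lid k (H β))
        (TensorProduct.map (lam α) (LinearMap.id : H β →ₗ[k] H β) (Δ α β x))
      = lam (α * β) x • (1 : H β)

/-- A `π`-grouplike element of `H`. -/
def IsGrouplike (g : ∀ α : π, H α) : Prop :=
  (∀ α β : π, Δ α β (g (α * β)) = g α ⊗ₜ[k] g β) ∧ ε (k := k) (H := H) (g 1) = 1

/-- `g` is the distinguished `π`-grouplike element of `H`. -/
def IsDistinguishedGrouplike (g : ∀ α : π, H α) : Prop :=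
  IsGrouplike k H g ∧
    ∀ lam : ∀ α : π, H α →ₗ[k] k, IsRightIntegral k H lam →
      ∀ (α β : π) (x : H (α * β)),
        (TensorProduct.rid k (H α))
            (TensorProduct.map (LinearMap.id : H α →ₗ[k] H α) (lam β) (Δ α β x))
          = lam (α * β) x • g α

/-- `ν` is the distinguished grouplike element of `H₁*`. -/
def IsDistinguishedNu (ν : H (1 : π) →ₐ[k] k) : Prop :=
  ∀ Λ : H (1 : π), (∀ x : H (1 : π), x * Λ = ε (k := k) (H := H) x • Λ) →
    ∀ x : H (1 : π), Λ * x = ν x • Λ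

/-- The right action `a ↼ f` of `f ∈ H₁*` on `a ∈ H α`. -/
def hitR (f : H (1 : π) →ₗ[k] k) {α : π} (a : H α) : H α :=
  (TensorProduct.lid k (H α))
    (TensorProduct.map f (LinearMap.id : H α →ₗ[k] H α)
      (Δ 1 α ((gcast k H (one_mul α).symm) a)))

/-- The left action `f ⇀ a` of `f ∈ H₁*` on `a ∈ H α`. -/
def hitL (f : H (1 : π) →ₗ[k] k) {α : π} (a : H α) : H α :=
  (TensorProduct.rid k (H α))
    (TensorProduct.map (LinearMap.id : H α →ₗ[k] H α) f
      (Δ α 1 ((gcast k H (mul_one α).symm) a)))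


/-- The comultiplication, with all arguments explicit. -/
def comul (α β : π) : H (α * β) →ₐ[k] H α ⊗[k] H β := Δ α β

/-- The counit, with all arguments explicit. -/
def counit : H (1 : π) →ₐ[k] k := ε

/-- The antipode, with all arguments explicit. -/
def antipode (α : π) : H α →ₗ[k] H α⁻¹ := S α

end HopfGCoalgebra

open HopfGCoalgebra
/-- A right Hopf `π`-comodule over `H`. -/
class HopfGComodule (k : Type*) [Field k] {π : Type*} [Group π]
    (H : π → Type*) [∀ α, Ring (H α)] [∀ α, Algebra k (H α)] [HopfGCoalgebra k H]
    (M : π → Type*) [∀ α, AddCommGroup (M α)] [∀ α, Module k (M α)] where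
  ρ : ∀ α β : π, M (α * β) →ₗ[k] M α ⊗[k] H β
  ρ_coassoc : ∀ α β γ : π,
    (TensorProduct.assoc k (M α) (H β) (H γ)).toLinearMap ∘ₗ
        (TensorProduct.map (ρ α β) (LinearMap.id : H γ →ₗ[k] H γ)) ∘ₗ (ρ (α * β) γ)
      = (TensorProduct.map (LinearMap.id : M α →ₗ[k] M α) (Δ β γ).toLinearMap) ∘ₗ
        (ρ α (β * γ)) ∘ₗ (fcast k M (mul_assoc α β γ)).toLinearMap
  ρ_counit : ∀ α : π,
    (TensorProduct.rid k (M α)).toLinearMap ∘ₗ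
        (TensorProduct.map (LinearMap.id : M α →ₗ[k] M α)
          (ε (k := k) (H := H)).toLinearMap) ∘ₗ
        (ρ α 1) ∘ₗ (fcast k M (mul_one α).symm).toLinearMap = LinearMap.id
  act : ∀ α : π, M α →ₗ[k] H α →ₗ[k] M α
  act_one : ∀ (α : π) (m : M α), act α m 1 = m
  act_mul : ∀ (α : π) (m : M α) (a b : H α), act α (act α m a) b = act α m (a * b)
  ρ_act : ∀ (α β : π) (m : M (α * β)) (a : H (α * β)),
    ρ α β (act (α * β) m a)
      = TensorProduct.map (TensorProduct.lift (act α)) (LinearMap.mul' k (H β))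
          ((TensorProduct.tensorTensorTensorComm k (M α) (H β) (H α) (H β))
            (ρ α β m ⊗ₜ[k] (Δ α β a)))

namespace HopfGComodule

variable (k : Type*) [Field k] {π : Type*} [Group π] (H : π → Type*)
  [∀ α, Ring (H α)] [∀ α, Algebra k (H α)] [HopfGCoalgebra k H]
  (M : π → Type*) [∀ α, AddCommGroup (M α)] [∀ α, Module k (M α)] [HopfGComodule k H M]

/-- The submodule of coinvariant families of `H` on `M`. -/
def coinvFam : Submodule k (∀ α, M α) where
  carrier := {m | ∀ α β : π, ρ (H := H) α β (m (α * β)) = m α ⊗ₜ[k] (1 : H β)}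
  add_mem' := by
    intro a b ha hb α β
    simp only [Pi.add_apply, map_add, ha α β, hb α β, TensorProduct.add_tmul]
  zero_mem' := by
    intro α β
    simp only [Pi.zero_apply, map_zero, TensorProduct.zero_tmul]
  smul_mem' := by
    intro c a ha α β
    simp only [Pi.smul_apply, map_smul, ha α β, TensorProduct.smul_tmul']

/-- The `α`-component of the `π`-subcomodule of coinvariants. -/
def coinvSub (α : π) : Submodule k (M α) :=
  (coinvFam k H M).map (LinearMap.proj α : (∀ γ, M γ) →ₗ[k] M α)


/-- The comodule structure maps, with all arguments explicit. -/
def coact (α β : π) : M (α * β) →ₗ[k] M α ⊗[k] H β := ρ α β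

/-- The right `H α`-action on `M α`, with all arguments explicit. -/
def hact (α : π) : M α →ₗ[k] H α →ₗ[k] M α := act α

end HopfGComodule

section Cosemisimple

variable (k : Type*) [Field k] {π : Type*} [Group π] (H : π → Type*)
  [∀ α, Ring (H α)] [∀ α, Algebra k (H α)]
  (M : π → Type*) [∀ α, AddCommGroup (M α)] [∀ α, Module k (M α)]

/-- `N` is a `π`-subcomodule of the right `π`-comodule `(M, ρ)` over `H`. -/
def IsGSubcomodule (ρ : ∀ α β : π, M (α * β) →ₗ[k] M α ⊗[k] H β)
    (N : ∀ α, Submodule k (M α)) : Prop :=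
  ∀ (α β : π), ∀ x ∈ N (α * β),
    ρ α β x ∈ LinearMap.range
      (TensorProduct.map (N α).subtype (LinearMap.id : H β →ₗ[k] H β))

/-- `N` is a simple `π`-subcomodule of `(M, ρ)`. -/
def IsSimpleGSubcomodule (ρ : ∀ α β : π, M (α * β) →ₗ[k] M α ⊗[k] H β)
    (N : ∀ α, Submodule k (M α)) : Prop :=
  IsGSubcomodule k H M ρ N ∧ (∃ α, N α ≠ ⊥) ∧
    ∀ P : ∀ α, Submodule k (M α), IsGSubcomodule k H M ρ P → (∀ α, P α ≤ N α) →
      (∀ α, P α = ⊥) ∨ P = N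

/-- The right `π`-comodule `(M, ρ)` is cosemisimple: it is the sum of its simple
`π`-subcomodules. -/
def IsGCosemisimple (ρ : ∀ α β : π, M (α * β) →ₗ[k] M α ⊗[k] H β) : Prop :=
  ∀ α : π,
    (⨆ N : {N : ∀ γ, Submodule k (M γ) // IsSimpleGSubcomodule k H M ρ N}, N.1 α) = ⊤

end Cosemisimple

section CoalgCosemisimple

variable (k : Type*) [Field k] (C : Type*) [AddCommGroup C] [Module k C]

/-- `N` is a subcomodule of the coalgebra `(C, δ)` viewed as a right comodule over itself. -/
def IsSubcoideal (δ : C →ₗ[k] C ⊗[k] C) (N : Submodule k C) : Prop :=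
  ∀ x ∈ N, δ x ∈ LinearMap.range (TensorProduct.map N.subtype (LinearMap.id : C →ₗ[k] C))

def IsSimpleSubcoideal (δ : C →ₗ[k] C ⊗[k] C) (N : Submodule k C) : Prop :=
  IsSubcoideal k C δ N ∧ N ≠ ⊥ ∧
    ∀ P : Submodule k C, IsSubcoideal k C δ P → P ≤ N → P = ⊥ ∨ P = N

/-- The coalgebra `(C, δ)` is cosemisimple. -/
def IsCosemisimpleCoalgebra (δ : C →ₗ[k] C ⊗[k] C) : Prop :=
  (⨆ N : {N : Submodule k C // IsSimpleSubcoideal k C δ N}, N.1) = ⊤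

end CoalgCosemisimple
/-- A crossed Hopf `π`-coalgebra: a Hopf `π`-coalgebra with a crossing `φ`. -/
class CrossedHopfGCoalgebra (k : Type*) [Field k] {π : Type*} [Group π]
    (H : π → Type*) [∀ α, Ring (H α)] [∀ α, Algebra k (H α)]
    extends HopfGCoalgebra k H where
  φ : ∀ β α : π, H α ≃ₐ[k] H (β * α * β⁻¹)
  φ_comul : ∀ β α γ : π,
    (TensorProduct.map (φ β α).toLinearMap (φ β γ).toLinearMap) ∘ₗ (Δ α γ).toLinearMap
      = (Δ (β * α * β⁻¹) (β * γ * β⁻¹)).toLinearMap ∘ₗ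
        (gcast k H (show β * (α * γ) * β⁻¹ = (β * α * β⁻¹) * (β * γ * β⁻¹) by
          group)).toLinearMap ∘ₗ (φ β (α * γ)).toLinearMap
  φ_counit : ∀ (β : π) (x : H (1 : π)),
    ε ((gcast k H (show β * 1 * β⁻¹ = (1 : π) by group)) (φ β 1 x)) = ε x
  φ_mul : ∀ (β β' α : π) (x : H α),
    (gcast k H (show β * (β' * α * β'⁻¹) * β⁻¹ = (β * β') * α * (β * β')⁻¹ by group))
        (φ β (β' * α * β'⁻¹) (φ β' α x))
      = φ (β * β') α x


namespace CrossedHopfGCoalgebra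

variable (k : Type*) [Field k] {π : Type*} [Group π] (H : π → Type*)
  [∀ α, Ring (H α)] [∀ α, Algebra k (H α)] [CrossedHopfGCoalgebra k H]

/-- The crossing, with all arguments explicit. -/
def crossing (β α : π) : H α ≃ₐ[k] H (β * α * β⁻¹) := φ β α

end CrossedHopfGCoalgebra

open CrossedHopfGCoalgebra

/-- A quasitriangular Hopf `π`-coalgebra: a crossed Hopf `π`-coalgebra with an R-matrix. -/
class QTHopfGCoalgebra (k : Type*) [Field k] {π : Type*} [Group π]
    (H : π → Type*) [∀ α, Ring (H α)] [∀ α, Algebra k (H α)]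
    extends CrossedHopfGCoalgebra k H where
  Rm : ∀ α β : π, H α ⊗[k] H β
  Rm_isUnit : ∀ α β : π, IsUnit (Rm α β)
  Rm_comul : ∀ (α β : π) (x : H (α * β)),
    Rm α β * Δ α β x
      = (TensorProduct.comm k (H β) (H α))
          ((TensorProduct.map
              ((gcast k H (show α⁻¹ * (α * β * α⁻¹) * α⁻¹⁻¹ = β by group)).toLinearMap ∘ₗ
                (φ α⁻¹ (α * β * α⁻¹)).toLinearMap)
              (LinearMap.id : H α →ₗ[k] H α))
            ((Δ (α * β * α⁻¹) α)
              ((gcast k H (show α * β = (α * β * α⁻¹) * α by group)) x))) * Rm α β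
  Rm_delta_right : ∀ α β γ : π,
    TensorProduct.map (LinearMap.id : H α →ₗ[k] H α) (Δ β γ).toLinearMap (Rm α (β * γ))
      = (TensorProduct.map (LinearMap.id : H α →ₗ[k] H α)
            (TensorProduct.mk k (H β) (H γ) 1) (Rm α γ))
        * (TensorProduct.map (LinearMap.id : H α →ₗ[k] H α)
            ((TensorProduct.mk k (H β) (H γ)).flip 1) (Rm α β))
  Rm_delta_left : ∀ α β γ : π,
    (TensorProduct.assoc k (H α) (H β) (H γ))
        (TensorProduct.map (Δ α β).toLinearMap (LinearMap.id : H γ →ₗ[k] H γ)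
          (Rm (α * β) γ))
      = (TensorProduct.map (LinearMap.id : H α →ₗ[k] H α)
            (TensorProduct.mk k (H β) (H γ) 1)
            (TensorProduct.map (LinearMap.id : H α →ₗ[k] H α)
              ((gcast k H (show β⁻¹ * (β * γ * β⁻¹) * β⁻¹⁻¹ = γ by group)).toLinearMap ∘ₗ
                (φ β⁻¹ (β * γ * β⁻¹)).toLinearMap)
              (Rm α (β * γ * β⁻¹))))
        * (TensorProduct.mk k (H α) (H β ⊗[k] H γ) 1 (Rm β γ))
  Rm_phi : ∀ β α γ : π,
    TensorProduct.map (φ β α).toLinearMap (φ β γ).toLinearMap (Rm α γ)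
      = Rm (β * α * β⁻¹) (β * γ * β⁻¹)

namespace QTHopfGCoalgebra

variable (k : Type*) [Field k] {π : Type*} [Group π] (H : π → Type*)
  [∀ α, Ring (H α)] [∀ α, Algebra k (H α)] [QTHopfGCoalgebra k H]

/-- The square of the antipode `S_{α⁻¹} ∘ S_α : H α → H α`. -/
def antipodeSq (α : π) : H α →ₗ[k] H α :=
  (gcast k H (inv_inv α)).toLinearMap ∘ₗ S α⁻¹ ∘ₗ S α

/-- The map `S_{α⁻¹} ∘ φ_α : H (α⁻¹) → H α`. -/
def sphi (α : π) : H α⁻¹ →ₗ[k] H α :=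
  (gcast k H (inv_inv α)).toLinearMap ∘ₗ S α⁻¹ ∘ₗ
    (gcast k H (show α * α⁻¹ * α⁻¹ = α⁻¹ by group)).toLinearMap ∘ₗ
    (φ α α⁻¹).toLinearMap

/-- The Drinfeld element `u_α = m_α ∘ (S_{α⁻¹}φ_α ⊗ id) ∘ σ_{α,α⁻¹} (R_{α,α⁻¹})`. -/
def drinfeld (α : π) : H α :=
  LinearMap.mul' k (H α)
    (TensorProduct.map (sphi k H α) (LinearMap.id : H α →ₗ[k] H α)
      ((TensorProduct.comm k (H α) (H α⁻¹)) (Rm α α⁻¹)))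

/-- The element `S_{α⁻¹}(u_{α⁻¹}) ∈ H α`. -/
def sdrinfeld (α : π) : H α :=
  (gcast k H (inv_inv α)) (S (k := k) (H := H) α⁻¹ (drinfeld k H α⁻¹))

/-- The `π`-grouplike element `ℓ_α = S_{α⁻¹}(u_{α⁻¹})⁻¹ u_α`. -/
def ell (α : π) : H α :=
  Ring.inverse (sdrinfeld k H α) * drinfeld k H α


/-- The R-matrix, with all arguments explicit. -/
def rmatrix (α β : π) : H α ⊗[k] H β := Rm α β

end QTHopfGCoalgebra

open QTHopfGCoalgebra

theorem gcast_gcast_symm {k : Type*} [CommSemiring k] {π : Type*} {H : π → Type*}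
    [∀ α, Ring (H α)] [∀ α, Algebra k (H α)] {a b : π} (h : a = b) (x : H b) :
    gcast k H h (gcast k H h.symm x) = x := by
  subst h
  rfl

/-- A tensor lies in `N ⊗ B` iff every slice of it along a functional on `B` lies in `N`. -/
theorem mem_range_map_subtype_iff {k A B : Type*} [Field k] [AddCommGroup A] [Module k A]
    [AddCommGroup B] [Module k B] (N : Submodule k A) (t : A ⊗[k] B) :
    t ∈ LinearMap.range (TensorProduct.map N.subtype (LinearMap.id : B →ₗ[k] B)) ↔
      ∀ φ : B →ₗ[k] k, TensorProduct.rid k A (TensorProduct.map LinearMap.id φ t) ∈ N := by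
  constructor
  · rintro ⟨z, rfl⟩ φ
    induction z with
    | zero => simp
    | tmul n b => simpa using N.smul_mem _ n.2
    | add x y hx hy => simpa using N.add_mem hx hy
  · intro h
    obtain ⟨⟨ι, b⟩⟩ := Module.Free.exists_basis (R := k) (M := B)
    obtain ⟨c, rfl⟩ := TensorProduct.eq_repr_basis_right b t
    refine Submodule.sum_mem _ fun i hc => ?_
    have hi : c i ∈ N := by
      classical
      have := h (b.coord i)
      simp only [Finsupp.sum, map_sum, TensorProduct.map_tmul, LinearMap.id_apply,
        TensorProduct.rid_tmul, Module.Basis.coord_apply, Module.Basis.repr_self,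
        Finsupp.single_apply, ite_smul, one_smul, zero_smul, Finset.sum_ite_eq'] at this
      rwa [if_pos hc] at this
    exact ⟨⟨c i, hi⟩ ⊗ₜ b i, by simp⟩

namespace HopfGCoalgebra

variable {k : Type*} [Field k] {π : Type*} [Group π] {H : π → Type*}
  [∀ α, Ring (H α)] [∀ α, Algebra k (H α)] [HopfGCoalgebra k H]

variable (k H) in
/-- The comultiplication `H γ → H α ⊗ H β` along an equality `α * β = γ`. -/
def comulOfEq {α β γ : π} (h : α * β = γ) : H γ →ₗ[k] H α ⊗[k] H β :=
  (comul k H α β).toLinearMap ∘ₗ (gcast k H h.symm).toLinearMap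

theorem comulOfEq_coassoc {α β γ δ η ζ : π} (hδ : α * β = δ) (hη : β * γ = η)
    (h : δ * γ = ζ) (h' : α * η = ζ) (x : H ζ) :
    TensorProduct.assoc k (H α) (H β) (H γ)
        (TensorProduct.map (comulOfEq k H hδ) LinearMap.id (comulOfEq k H h x)) =
      TensorProduct.map LinearMap.id (comulOfEq k H hη) (comulOfEq k H h' x) := by
  subst hδ hη h
  exact LinearMap.congr_fun (HopfGCoalgebra.coassoc (k := k) (H := H) α β γ) x

/-- The slice `x ↦ (id ⊗ φ) (Δ x)` of the comultiplication. -/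
def slice {α β γ : π} (h : α * β = γ) (φ : H β →ₗ[k] k) : H γ →ₗ[k] H α :=
  (TensorProduct.rid k (H α)).toLinearMap ∘ₗ
    TensorProduct.map LinearMap.id φ ∘ₗ comulOfEq k H h

theorem slice_apply {α β γ : π} (h : α * β = γ) (φ : H β →ₗ[k] k) (x : H γ) :
    slice h φ x =
      TensorProduct.rid k (H α) (TensorProduct.map LinearMap.id φ (comulOfEq k H h x)) := rfl

theorem slice_counit (α : π) (x : H α) :
    slice (mul_one α) (counit k H).toLinearMap x = x :=
  LinearMap.congr_fun (HopfGCoalgebra.counit_right (k := k) (H := H) α) x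

/-- Slicing by a functional that factors through `Δ`, in terms of the iterated comultiplication. -/
theorem slice_comp_comulOfEq {α β γ δ η ζ : π} (hδ : α * β = δ) (hη : β * γ = η)
    (h : δ * γ = ζ) (h' : α * η = ζ) (θ : H β ⊗[k] H γ →ₗ[k] k) (x : H ζ) :
    slice h' (θ ∘ₗ comulOfEq k H hη) x =
      TensorProduct.rid k (H α) (TensorProduct.map LinearMap.id θ
        (TensorProduct.assoc k (H α) (H β) (H γ)
          (TensorProduct.map (comulOfEq k H hδ) LinearMap.id (comulOfEq k H h x)))) := by
  rw [comulOfEq_coassoc hδ hη h h']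
  rw [slice_apply, TensorProduct.map_map, LinearMap.id_comp]

theorem rid_map_assoc_tmul {α β γ δ : π} (hδ : α * β = δ) (θ : H β ⊗[k] H γ →ₗ[k] k)
    (y : H δ) (b : H γ) :
    TensorProduct.rid k (H α) (TensorProduct.map LinearMap.id θ
        (TensorProduct.assoc k (H α) (H β) (H γ) (comulOfEq k H hδ y ⊗ₜ b))) =
      slice hδ (θ ∘ₗ (TensorProduct.mk k (H β) (H γ)).flip b) y := by
  rw [slice_apply]
  generalize comulOfEq k H hδ y = t
  induction t with
  | zero => simp
  | tmul u v => simp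
  | add u v hu hv => simp only [TensorProduct.add_tmul, map_add, hu, hv]

theorem slice_slice {α β γ δ η ζ : π} (hδ : α * β = δ) (hη : β * γ = η)
    (h : δ * γ = ζ) (h' : α * η = ζ) (ψ : H β →ₗ[k] k) (φ : H γ →ₗ[k] k) (x : H ζ) :
    slice hδ ψ (slice h φ x) =
      slice h' ((LinearMap.mul' k k ∘ₗ TensorProduct.map ψ φ) ∘ₗ comulOfEq k H hη) x := by
  rw [slice_comp_comulOfEq hδ hη h h']
  rw [slice_apply h]
  generalize comulOfEq k H h x = t
  induction t with
  | zero => simp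
  | tmul u v =>
    rw [TensorProduct.map_tmul, TensorProduct.map_tmul, LinearMap.id_apply, LinearMap.id_apply,
      rid_map_assoc_tmul]
    have hf : (LinearMap.mul' k k ∘ₗ TensorProduct.map ψ φ) ∘ₗ
        (TensorProduct.mk k (H β) (H γ)).flip v = φ v • ψ := by
      ext w
      simp [mul_comm]
    rw [hf]
    simp [slice_apply, TensorProduct.map_smul_right]
  | add u v hu hv => simp only [map_add, hu, hv]

theorem isGSubcomodule_iff_slice_mem (N : ∀ α, Submodule k (H α)) :
    IsGSubcomodule k H H (fun α β => (comul k H α β).toLinearMap) N ↔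
      ∀ {α β γ : π} (h : α * β = γ) (φ : H β →ₗ[k] k), ∀ x ∈ N γ, slice h φ x ∈ N α := by
  constructor
  · rintro hN α β _ rfl φ x hx
    exact (mem_range_map_subtype_iff _ _).1 (hN α β x hx) φ
  · intro hN α β x hx
    exact (mem_range_map_subtype_iff _ _).2 fun φ => hN rfl φ x hx

theorem isSubcoideal_iff_slice_mem (N : Submodule k (H 1)) :
    IsSubcoideal k (H 1) ((comul k H 1 1).toLinearMap ∘ₗ
        (gcast k H (one_mul (1 : π)).symm).toLinearMap) N ↔
      ∀ φ : H 1 →ₗ[k] k, ∀ x ∈ N, slice (one_mul (1 : π)) φ x ∈ N :=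
  ⟨fun hN φ x hx => (mem_range_map_subtype_iff _ _).1 (hN x hx) φ,
    fun hN x hx => (mem_range_map_subtype_iff _ _).2 fun φ => hN φ x hx⟩

variable (k H) in
/-- The `π`-subcomodule of `H` cotensored up from a subspace `N` of `H 1`: its `α`-component
consists of the `x` with `Δ x ∈ N ⊗ H α`. -/
def cotensor (N : Submodule k (H (1 : π))) (α : π) : Submodule k (H α) :=
  ⨅ φ : H α →ₗ[k] k, N.comap (slice (one_mul α) φ)

theorem mem_cotensor {N : Submodule k (H (1 : π))} {α : π} {x : H α} :
    x ∈ cotensor k H N α ↔ ∀ φ : H α →ₗ[k] k, slice (one_mul α) φ x ∈ N := by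
  simp [cotensor, Submodule.mem_iInf]

theorem isGSubcomodule_cotensor (N : Submodule k (H (1 : π))) :
    IsGSubcomodule k H H (fun α β => (comul k H α β).toLinearMap) (cotensor k H N) := by
  rw [isGSubcomodule_iff_slice_mem]
  intro α β γ h φ x hx
  rw [mem_cotensor] at hx ⊢
  intro ψ
  rw [slice_slice (one_mul α) h h (one_mul γ)]
  exact hx _

theorem cotensor_one {N : Submodule k (H (1 : π))}
    (hN : IsSubcoideal k (H 1) ((comul k H 1 1).toLinearMap ∘ₗ
      (gcast k H (one_mul (1 : π)).symm).toLinearMap) N) : cotensor k H N 1 = N := by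
  ext x
  rw [mem_cotensor]
  refine ⟨fun h => ?_, fun hx φ => (isSubcoideal_iff_slice_mem N).1 hN φ x hx⟩
  have := h (counit k H).toLinearMap
  rwa [slice_counit] at this

theorem isSubcoideal_one {N : ∀ α, Submodule k (H α)}
    (hN : IsGSubcomodule k H H (fun α β => (comul k H α β).toLinearMap) N) :
    IsSubcoideal k (H 1) ((comul k H 1 1).toLinearMap ∘ₗ
      (gcast k H (one_mul (1 : π)).symm).toLinearMap) (N 1) :=
  (isSubcoideal_iff_slice_mem _).2 fun φ x hx => (isGSubcomodule_iff_slice_mem N).1 hN _ φ x hx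

theorem isGSubcomodule_inf {N P : ∀ α, Submodule k (H α)}
    (hN : IsGSubcomodule k H H (fun α β => (comul k H α β).toLinearMap) N)
    (hP : IsGSubcomodule k H H (fun α β => (comul k H α β).toLinearMap) P) :
    IsGSubcomodule k H H (fun α β => (comul k H α β).toLinearMap) (fun α => N α ⊓ P α) := by
  rw [isGSubcomodule_iff_slice_mem] at *
  exact fun h φ x hx => ⟨hN h φ x hx.1, hP h φ x hx.2⟩

theorem isGSubcomodule_iSup {ι : Type*} {N : ι → ∀ α, Submodule k (H α)}
    (hN : ∀ i, IsGSubcomodule k H H (fun α β => (comul k H α β).toLinearMap) (N i)) :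
    IsGSubcomodule k H H (fun α β => (comul k H α β).toLinearMap) (fun α => ⨆ i, N i α) := by
  rw [isGSubcomodule_iff_slice_mem]
  intro α β γ h φ
  change (⨆ i, N i γ) ≤ (⨆ i, N i α).comap (slice h φ)
  exact iSup_le fun i x hx =>
    Submodule.mem_iSup_of_mem i ((isGSubcomodule_iff_slice_mem _).1 (hN i) h φ x hx)

/-- If `Q` is a `π`-subcomodule, every `x` all of whose slices in `H 1` lie in `Q 1` lies in `Q`. -/
theorem mem_of_slice_mem {Q : ∀ α, Submodule k (H α)}
    (hQ : IsGSubcomodule k H H (fun α β => (comul k H α β).toLinearMap) Q) {α : π} {x : H α}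
    (hx : ∀ φ : H α →ₗ[k] k, slice (one_mul α) φ x ∈ Q 1) : x ∈ Q α := by
  rcases subsingleton_or_nontrivial (H α) with hα | hα
  · rw [Subsingleton.elim x 0]
    exact zero_mem _
  obtain ⟨χ, hχ⟩ := Module.Projective.exists_dual_ne_zero k (one_ne_zero (α := H α))
  let θ : H α⁻¹ ⊗[k] H α →ₗ[k] k := (χ 1)⁻¹ • χ ∘ₗ LinearMap.mul' k (H α) ∘ₗ
    TensorProduct.map ((gcast k H (inv_inv α)).toLinearMap ∘ₗ antipode k H α⁻¹) LinearMap.id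
  have hθ : θ ∘ₗ comulOfEq k H (inv_mul_cancel α) = (counit k H).toLinearMap := by
    ext y
    have h := LinearMap.congr_fun (HopfGCoalgebra.antipode_left (k := k) (H := H) α)
      (gcast k H (inv_mul_cancel α).symm y)
    change LinearMap.mul' k (H α) (TensorProduct.map _ LinearMap.id
      (comulOfEq k H (inv_mul_cancel α) y)) = algebraMap k (H α) (counit k H
      (gcast k H (inv_mul_cancel α) (gcast k H (inv_mul_cancel α).symm y))) at h
    rw [gcast_gcast_symm, Algebra.algebraMap_eq_smul_one] at h
    change (χ 1)⁻¹ * χ _ = counit k H y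
    refine (congrArg (fun w => (χ 1)⁻¹ * χ w) h).trans ?_
    simp only [map_smul, smul_eq_mul]
    field_simp
  obtain ⟨z, hz⟩ := (mem_range_map_subtype_iff (Q 1) (comulOfEq k H (one_mul α) x)).2 hx
  rw [← slice_counit (k := k) α x, ← hθ,
    slice_comp_comulOfEq (mul_inv_cancel α) (inv_mul_cancel α) (one_mul α) (mul_one α), ← hz]
  clear hz
  induction z with
  | zero => simp
  | tmul q b =>
    rw [TensorProduct.map_tmul, TensorProduct.map_tmul, LinearMap.id_apply, LinearMap.id_apply,
      rid_map_assoc_tmul]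
    exact (isGSubcomodule_iff_slice_mem Q).1 hQ _ _ _ q.2
  | add u v hu hv => simpa only [map_add] using (Q α).add_mem hu hv

theorem eq_bot_of_one_eq_bot {N : ∀ α, Submodule k (H α)}
    (hN : IsGSubcomodule k H H (fun α β => (comul k H α β).toLinearMap) N) (h : N 1 = ⊥)
    (α : π) : N α = ⊥ := by
  rw [eq_bot_iff]
  intro x hx
  refine mem_of_slice_mem (Q := fun _ => ⊥) ?_ fun φ => ?_
  · rw [isGSubcomodule_iff_slice_mem]
    rintro α β γ h φ x rfl
    simp
  · rw [← h]
    exact (isGSubcomodule_iff_slice_mem N).1 hN _ φ x hx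

theorem isSimpleSubcoideal_one {N : ∀ α, Submodule k (H α)}
    (hN : IsSimpleGSubcomodule k H H (fun α β => (comul k H α β).toLinearMap) N) :
    IsSimpleSubcoideal k (H 1) ((comul k H 1 1).toLinearMap ∘ₗ
      (gcast k H (one_mul (1 : π)).symm).toLinearMap) (N 1) := by
  obtain ⟨hsub, ⟨α, hα⟩, hmin⟩ := hN
  refine ⟨isSubcoideal_one hsub, fun h => hα (eq_bot_of_one_eq_bot hsub h α), fun P hP hPN => ?_⟩
  have hone : cotensor k H P 1 ⊓ N 1 = P := by rw [cotensor_one hP, inf_eq_left.2 hPN]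
  rcases hmin _ (isGSubcomodule_inf (isGSubcomodule_cotensor P) hsub) fun _ => inf_le_right
    with h | h
  · exact Or.inl (hone ▸ h 1)
  · exact Or.inr (hone ▸ congrFun h 1)

theorem isSimpleGSubcomodule_cotensor {N : Submodule k (H (1 : π))}
    (hN : IsSimpleSubcoideal k (H 1) ((comul k H 1 1).toLinearMap ∘ₗ
      (gcast k H (one_mul (1 : π)).symm).toLinearMap) N) :
    IsSimpleGSubcomodule k H H (fun α β => (comul k H α β).toLinearMap) (cotensor k H N) := by
  obtain ⟨hsub, hne, hmin⟩ := hN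
  refine ⟨isGSubcomodule_cotensor N, ⟨1, by rwa [cotensor_one hsub]⟩, fun Q hQ hQN => ?_⟩
  rcases hmin _ (isSubcoideal_one hQ) ((hQN 1).trans (cotensor_one hsub).le) with h | h
  · exact Or.inl (eq_bot_of_one_eq_bot hQ h)
  · refine Or.inr (funext fun α => le_antisymm (hQN α) fun x hx => mem_of_slice_mem hQ fun φ => ?_)
    rw [h]
    exact mem_cotensor.1 hx φ

variable (k H) in
/-- A Hopf `π`-coalgebra `H` is cosemisimple iff `H 1` is, without any finiteness assumption. -/
theorem isGCosemisimple_iff_isCosemisimpleCoalgebra_one :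
    IsGCosemisimple k H H (fun α β => (comul k H α β).toLinearMap) ↔
      IsCosemisimpleCoalgebra k (H 1) ((comul k H 1 1).toLinearMap ∘ₗ
        (gcast k H (one_mul (1 : π)).symm).toLinearMap) := by
  constructor
  · intro h
    refine top_le_iff.1 ((h 1).ge.trans (iSup_le fun N => ?_))
    exact le_iSup (fun N : {N : Submodule k (H 1) // IsSimpleSubcoideal k (H 1) _ N} => N.1)
      ⟨N.1 1, isSimpleSubcoideal_one N.2⟩
  · intro h α
    have hone : (⨆ N : {N : ∀ γ, Submodule k (H γ) // IsSimpleGSubcomodule k H H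
        (fun α β => (comul k H α β).toLinearMap) N}, N.1 1) = ⊤ := by
      refine top_le_iff.1 (h.ge.trans (iSup_le fun N => ?_))
      rw [← cotensor_one N.2.1]
      exact le_iSup (fun N : {N : ∀ γ, Submodule k (H γ) // IsSimpleGSubcomodule k H H
        (fun α β => (comul k H α β).toLinearMap) N} => N.1 1)
        ⟨_, isSimpleGSubcomodule_cotensor N.2⟩
    refine top_le_iff.1 fun x _ => mem_of_slice_mem (isGSubcomodule_iSup fun N => N.2.1) fun φ => ?_
    rw [hone]
    trivial

end HopfGCoalgebra

/-- Corollary 5.3: if `H` is cosemisimple then the Hopf algebra `H₁` is cosemisimple;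
if `H` is finite dimensional, `H` is cosemisimple iff `H₁` is cosemisimple. -/
theorem cosemisimple_component_one (k : Type*) [Field k] {π : Type*} [Group π]
    (H : π → Type*) [∀ α, Ring (H α)] [∀ α, Algebra k (H α)] [HopfGCoalgebra k H] :
    (IsGCosemisimple k H H (fun α β => (comul k H α β).toLinearMap) →
      IsCosemisimpleCoalgebra k (H 1)
        ((comul k H 1 1).toLinearMap ∘ₗ (gcast k H (one_mul (1 : π)).symm).toLinearMap)) ∧
    ((∀ α : π, FiniteDimensional k (H α)) →
      (IsGCosemisimple k H H (fun α β => (comul k H α β).toLinearMap)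
        ↔ IsCosemisimpleCoalgebra k (H 1)
            ((comul k H 1 1).toLinearMap ∘ₗ
              (gcast k H (one_mul (1 : π)).symm).toLinearMap))) := by
  have h := isGCosemisimple_iff_isCosemisimpleCoalgebra_one k H
  exact ⟨h.1, fun _ => h⟩
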